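/- Let d ≥ 1, σ_X, σ_Y > 0, C ⊆ ℝ^d nonempty, θ̂ : ℝ^d → ℝ^d measurable with E_θ‖θ̂(X) − θ‖² < ∞ for all θ ∈ C, and let α₀ ∈ (-1, 0]. Define ε(α), τ(α), k(α) as in the general cut-off construction and assume ε(α₀) > 0. Then for every c with 1 < c² ≤ k(α₀) and every α ∈ [-1, α₀], the predictive density q_{θ̂,c} dominates the plug-in density q_{θ̂,1} over C under the loss L_α, where L_α for α ∈ (-1,1) is the α-divergence loss and L_{-1} is the Kullback–Leibler loss. -/

import Mathlib

open MeasureTheory Real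

/-- Density of the `N_d(μ, v I_d)` distribution on `ℝ^d` (with `v` the variance). -/
noncomputable def gaussPdf (d : ℕ) (μ : EuclideanSpace ℝ (Fin d)) (v : ℝ)
    (y : EuclideanSpace ℝ (Fin d)) : ℝ :=
  (2 * π * v) ^ (-(d : ℝ) / 2) * Real.exp (-‖y - μ‖ ^ 2 / (2 * v))

/-- Loss `L_α` of a predictive density `p` for a target density `q` on `ℝ^d`:
the α-divergence loss for `α ∈ (-1,1)` and the Kullback–Leibler loss for `α = -1`. -/
noncomputable def lossA (d : ℕ) (α : ℝ) (q p : EuclideanSpace ℝ (Fin d) → ℝ) : ℝ :=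
  if α = -1 then ∫ y, q y * Real.log (q y / p y)
  else ∫ y, (4 / (1 - α ^ 2)) * (1 - (p y / q y) ^ ((1 + α) / 2)) * q y

/-- Frequentist `L_α` risk of the predictive density `N_d(θhat X, c²σ_Y² I_d)`
for the target `N_d(θ, σ_Y² I_d)`, with `X ~ N_d(θ, σ_X² I_d)`. -/
noncomputable def riskA (d : ℕ) (α σX σY : ℝ)
    (θhat : EuclideanSpace ℝ (Fin d) → EuclideanSpace ℝ (Fin d)) (c : ℝ)
    (θ : EuclideanSpace ℝ (Fin d)) : ℝ :=
  ∫ x, gaussPdf d θ (σX ^ 2) x *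
    lossA d α (gaussPdf d θ (σY ^ 2)) (gaussPdf d (θhat x) (c ^ 2 * σY ^ 2))

open scoped InnerProductSpace

lemma gp_exp (d : ℕ) (μ : EuclideanSpace ℝ (Fin d)) (v : ℝ) (hv : 0 < v)
    (y : EuclideanSpace ℝ (Fin d)) :
    gaussPdf d μ v y = Real.exp (-(d / 2) * Real.log (2 * π * v) - 1 / (2 * v) * ‖y - μ‖ ^ 2) := by
  have h : 0 < 2 * π * v := by positivity
  rw [gaussPdf, Real.rpow_def_of_pos h, ← Real.exp_add]
  congr 1
  ring

lemma int_exp0 (d : ℕ) (b : ℝ) (hb : 0 < b) :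
    Integrable (fun y : EuclideanSpace ℝ (Fin d) => Real.exp (-b * ‖y‖ ^ 2)) := by
  have h := (GaussianFourier.integrable_cexp_neg_mul_sq_norm_add (b := (b : ℂ))
    (by simpa using hb) 0 (0 : EuclideanSpace ℝ (Fin d))).re
  refine h.congr (Filter.Eventually.of_forall fun y => ?_)
  have : (-(b : ℂ) * (‖y‖ : ℂ) ^ 2 + 0 * ((inner ℝ (0 : EuclideanSpace ℝ (Fin d)) y : ℝ) : ℂ))
      = ((-b * ‖y‖ ^ 2 : ℝ) : ℂ) := by
    push_cast; ring
  simp only [this]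
  rw [← Complex.ofReal_exp]
  exact Complex.ofReal_re _

lemma int_exp (d : ℕ) (b : ℝ) (hb : 0 < b) (μ : EuclideanSpace ℝ (Fin d)) :
    Integrable (fun y : EuclideanSpace ℝ (Fin d) => Real.exp (-b * ‖y - μ‖ ^ 2)) :=
  (int_exp0 d b hb).comp_sub_right μ

lemma val_exp (d : ℕ) (b : ℝ) (hb : 0 < b) (μ : EuclideanSpace ℝ (Fin d)) :
    ∫ y : EuclideanSpace ℝ (Fin d), Real.exp (-b * ‖y - μ‖ ^ 2) =
      Real.exp (d / 2 * Real.log (π / b)) := by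
  rw [integral_sub_right_eq_self (fun y : EuclideanSpace ℝ (Fin d) => Real.exp (-b * ‖y‖ ^ 2)) μ,
    GaussianFourier.integral_rexp_neg_mul_sq_norm hb, Real.rpow_def_of_pos (by positivity)]
  simp
  ring

lemma gp_pos (d : ℕ) (μ : EuclideanSpace ℝ (Fin d)) (v : ℝ) (hv : 0 < v)
    (y : EuclideanSpace ℝ (Fin d)) : 0 < gaussPdf d μ v y := by
  rw [gp_exp d μ v hv]; positivity

lemma gp_int (d : ℕ) (μ : EuclideanSpace ℝ (Fin d)) (v : ℝ) (hv : 0 < v) :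
    Integrable (gaussPdf d μ v) := by
  have h := (int_exp d (1 / (2 * v)) (by positivity) μ).const_mul
    ((2 * π * v) ^ (-(d : ℝ) / 2))
  refine h.congr (Filter.Eventually.of_forall fun y => ?_)
  simp only [gaussPdf]
  congr 2
  ring

lemma gp_val (d : ℕ) (μ : EuclideanSpace ℝ (Fin d)) (v : ℝ) (hv : 0 < v) :
    ∫ y, gaussPdf d μ v y = 1 := by
  have : ∀ y, gaussPdf d μ v y = Real.exp (-(d / 2) * Real.log (2 * π * v)) *
      Real.exp (-(1 / (2 * v)) * ‖y - μ‖ ^ 2) := by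
    intro y
    rw [gp_exp d μ v hv, ← Real.exp_add]; congr 1; ring
  simp_rw [this]
  rw [integral_const_mul, val_exp d _ (by positivity), ← Real.exp_add, Real.exp_eq_one_iff]
  rw [show π / (1 / (2 * v)) = 2 * π * v by field_simp]
  ring

lemma two_pt (d : ℕ) (A B : ℝ) (h : 0 < A + B) (y θ μ : EuclideanSpace ℝ (Fin d)) :
    A * ‖y - θ‖ ^ 2 + B * ‖y - μ‖ ^ 2 =
      (A + B) * ‖y - (θ + (B / (A + B)) • (μ - θ))‖ ^ 2 + A * B / (A + B) * ‖μ - θ‖ ^ 2 := by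
  have e1 : y - μ = (y - θ) - (μ - θ) := by abel
  have e2 : y - (θ + (B / (A + B)) • (μ - θ)) = (y - θ) - (B / (A + B)) • (μ - θ) := by abel
  rw [e1, e2, norm_sub_sq_real (y - θ) (μ - θ), norm_sub_sq_real (y - θ) ((B / (A + B)) • (μ - θ)),
    norm_smul, inner_smul_right, mul_pow]
  simp only [Real.norm_eq_abs, sq_abs]
  field_simp
  ring

lemma loss_alpha (d : ℕ) (α v s : ℝ) (hα : -1 < α) (hα1 : α < 1) (hv : 0 < v) (hs : 0 < s)
    (θ μ : EuclideanSpace ℝ (Fin d)) :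
    lossA d α (gaussPdf d θ v) (gaussPdf d μ (s * v)) =
      4 / (1 - α ^ 2) * (1 - Real.exp (d / 2 * ((1 - α) / 2 * Real.log s
        - Real.log ((1 - α) / 2 * s + (1 + α) / 2))) *
        Real.exp (-((1 - α ^ 2) / 8 / ((1 - α) / 2 * s + (1 + α) / 2) * (‖μ - θ‖ ^ 2 / v)))) := by
  rw [lossA, if_neg (by linarith)]
  have hg : 0 < (1 - α) / 2 := by linarith
  have hb : 0 < (1 + α) / 2 := by linarith
  have hm : 0 < (1 - α) / 2 * s + (1 + α) / 2 := by positivity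
  set A : ℝ := (1 - α) / 2 * (1 / (2 * v)) with hA
  set B : ℝ := (1 + α) / 2 * (1 / (2 * (s * v))) with hB
  have hAB : 0 < A + B := by positivity
  have hABe : A + B = ((1 - α) / 2 * s + (1 + α) / 2) / (s * (2 * v)) := by
    rw [hA, hB]; field_simp
  set K : ℝ := -(d / 2) * ((1 - α) / 2 * Real.log (2 * π * v) +
    (1 + α) / 2 * Real.log (2 * π * (s * v))) - A * B / (A + B) * ‖μ - θ‖ ^ 2 with hK
  have key : ∀ y, 4 / (1 - α ^ 2) * (1 - (gaussPdf d μ (s * v) y / gaussPdf d θ v y) ^ ((1 + α) / 2))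
      * gaussPdf d θ v y = 4 / (1 - α ^ 2) * (gaussPdf d θ v y - Real.exp K *
        Real.exp (-(A + B) * ‖y - (θ + (B / (A + B)) • (μ - θ))‖ ^ 2)) := by
    intro y
    rw [mul_assoc, sub_mul, one_mul]
    congr 2
    rw [gp_exp d μ (s * v) (by positivity), gp_exp d θ v hv, ← Real.exp_sub, ← Real.exp_mul,
      ← Real.exp_add, ← Real.exp_add]
    congr 1
    have := two_pt d A B hAB y θ μ
    rw [hK]
    rw [show ∀ a b c : ℝ, a - b + -(A + B) * c = a - ((A + B) * c + b) by intros; ring, ← this]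
    rw [hA, hB]
    ring
  simp_rw [key]
  rw [integral_const_mul, integral_sub (gp_int d θ v hv) ((int_exp d _ hAB _).const_mul _),
    gp_val d θ v hv, integral_const_mul, val_exp d _ hAB, ← Real.exp_add, ← Real.exp_add]
  congr 3
  have l1 : Real.log (2 * π * (s * v)) = Real.log (2 * π * v) + Real.log s := by
    rw [← Real.log_mul (by positivity) (by positivity)]; congr 1; ring
  have l2 : Real.log (π / (A + B)) = Real.log (2 * π * v) + Real.log s -
      Real.log ((1 - α) / 2 * s + (1 + α) / 2) := by
    rw [← Real.log_mul (by positivity) (by positivity), ← Real.log_div (by positivity) (by positivity),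
      hABe]
    congr 1; field_simp
  have l3 : A * B / (A + B) * ‖μ - θ‖ ^ 2 =
      (1 - α ^ 2) / 8 / ((1 - α) / 2 * s + (1 + α) / 2) * (‖μ - θ‖ ^ 2 / v) := by
    rw [hABe, hA, hB]; field_simp; ring
  rw [hK, l1, l2, l3]
  ring

lemma mom0 (d : ℕ) (hd : 1 ≤ d) (b : ℝ) (hb : 0 < b) :
    Integrable (fun y : EuclideanSpace ℝ (Fin d) => ‖y‖ ^ 2 * Real.exp (-b * ‖y‖ ^ 2)) ∧
    ∫ y : EuclideanSpace ℝ (Fin d), ‖y‖ ^ 2 * Real.exp (-b * ‖y‖ ^ 2) =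
      d / (2 * b) * ∫ y : EuclideanSpace ℝ (Fin d), Real.exp (-b * ‖y‖ ^ 2) := by
  have : Nonempty (Fin d) := ⟨⟨0, hd⟩⟩
  have : Nontrivial (EuclideanSpace ℝ (Fin d)) := by
    apply Module.nontrivial_of_finrank_pos (R := ℝ); simp; omega
  have hd' : (1 : ℝ) ≤ d := by exact_mod_cast hd
  have e1 : ∀ y ∈ Set.Ioi (0 : ℝ), y ^ (d - 1) • Real.exp (-b * y ^ 2) =
      y ^ ((d : ℝ) - 1) * Real.exp (-b * y ^ (2 : ℝ)) := by
    intro y hy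
    rw [smul_eq_mul, ← Real.rpow_natCast y (d - 1), Nat.cast_sub hd]
    simp
  have e2 : ∀ y ∈ Set.Ioi (0 : ℝ), y ^ (d - 1) • (y ^ 2 * Real.exp (-b * y ^ 2)) =
      y ^ ((d : ℝ) + 1) * Real.exp (-b * y ^ (2 : ℝ)) := by
    intro y hy
    rw [smul_eq_mul, ← mul_assoc, ← pow_add, ← Real.rpow_natCast y (d - 1 + 2),
      show d - 1 + 2 = d + 1 by omega]
    simp
  constructor
  · rw [MeasureTheory.integrable_fun_norm_addHaar volume (f := fun r => r ^ 2 * Real.exp (-b * r ^ 2))]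
    simp only [finrank_euclideanSpace, Fintype.card_fin]
    rw [integrableOn_congr_fun e2 measurableSet_Ioi]
    exact integrableOn_rpow_mul_exp_neg_mul_rpow (by linarith) (by norm_num) hb
  · rw [integral_fun_norm_addHaar volume (fun r => r ^ 2 * Real.exp (-b * r ^ 2)),
      integral_fun_norm_addHaar volume (fun r => Real.exp (-b * r ^ 2))]
    simp only [finrank_euclideanSpace, Fintype.card_fin]
    rw [setIntegral_congr_fun measurableSet_Ioi e1, setIntegral_congr_fun measurableSet_Ioi e2,
      integral_rpow_mul_exp_neg_mul_rpow (by norm_num) (by linarith) hb,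
      integral_rpow_mul_exp_neg_mul_rpow (by norm_num) (by linarith) hb]
    rw [show ((d : ℝ) + 1 + 1) / 2 = d / 2 + 1 by ring, Real.Gamma_add_one (by positivity),
      show ((d : ℝ) - 1 + 1) / 2 = d / 2 by ring]
    simp only [nsmul_eq_mul, smul_eq_mul]
    rw [show -((d : ℝ) + 1 + 1) / 2 = -((d : ℝ) - 1 + 1) / 2 - 1 by ring, Real.rpow_sub_one hb.ne']
    field_simp

lemma int_lin3 {E : Type*} [MeasurableSpace E] {m : Measure E} {f g h : E → ℝ} (a b : ℝ)
    (hf : Integrable f m) (hg : Integrable g m) (hh : Integrable h m) :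
    ∫ x, (f x - a * g x + b * h x) ∂m = ∫ x, f x ∂m - a * ∫ x, g x ∂m + b * ∫ x, h x ∂m := by
  have h1 : ∫ x, (f x - a * g x + b * h x) ∂m = ∫ x, (f x - a * g x) ∂m + ∫ x, b * h x ∂m :=
    integral_add (hf.sub (hg.const_mul a)) (hh.const_mul b)
  rw [h1, integral_sub hf (hg.const_mul a), integral_const_mul, integral_const_mul]

lemma gp_mom (d : ℕ) (hd : 1 ≤ d) (v : ℝ) (hv : 0 < v) (θ μ : EuclideanSpace ℝ (Fin d)) :
    Integrable (fun y => gaussPdf d θ v y * ‖y - μ‖ ^ 2) ∧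
    ∫ y, gaussPdf d θ v y * ‖y - μ‖ ^ 2 = d * v + ‖μ - θ‖ ^ 2 := by
  have hb : 0 < 1 / (2 * v) := by positivity
  obtain ⟨i0, v0⟩ := mom0 d hd (1 / (2 * v)) hb
  set g0 : EuclideanSpace ℝ (Fin d) → ℝ := gaussPdf d 0 v with hg0
  have hg : ∀ y, g0 y = (2 * π * v) ^ (-(d : ℝ) / 2) * Real.exp (-(1 / (2 * v)) * ‖y‖ ^ 2) := by
    intro y; simp only [hg0, gaussPdf, sub_zero]; congr 2; ring
  have hgi : Integrable g0 := gp_int d 0 v hv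
  have hgv : ∫ y, g0 y = 1 := gp_val d 0 v hv
  have J0 : Integrable (fun y => g0 y * ‖y‖ ^ 2) := by
    refine (i0.const_mul ((2 * π * v) ^ (-(d : ℝ) / 2))).congr
      (Filter.Eventually.of_forall fun y => ?_)
    simp only [hg]; ring
  have V0 : ∫ y, g0 y * ‖y‖ ^ 2 = d * v := by
    have : ∀ y, g0 y * ‖y‖ ^ 2 = (2 * π * v) ^ (-(d : ℝ) / 2) *
      (‖y‖ ^ 2 * Real.exp (-(1 / (2 * v)) * ‖y‖ ^ 2)) := by intro y; rw [hg]; ring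
    simp_rw [this]
    rw [integral_const_mul, v0]
    simp_rw [hg] at hgv
    rw [integral_const_mul] at hgv
    rw [mul_left_comm, hgv]; field_simp
  set w := μ - θ with hw
  have J1 : Integrable (fun y => g0 y * inner ℝ y w) := by
    refine ((J0.add (hgi.mul_const (‖w‖ ^ 2)))).mono' ?_ (Filter.Eventually.of_forall fun y => ?_)
    · exact hgi.1.mul (by fun_prop)
    · rw [norm_mul, Real.norm_of_nonneg (gp_pos d 0 v hv y).le]
      have h1 := norm_inner_le_norm (𝕜 := ℝ) y w
      have h2 := gp_pos d 0 v hv y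
      have h3 : ‖inner ℝ y w‖ ≤ ‖y‖ ^ 2 + ‖w‖ ^ 2 := by
        nlinarith [sq_nonneg (‖y‖ - ‖w‖), sq_nonneg ‖y‖, sq_nonneg ‖w‖]
      calc g0 y * ‖inner ℝ y w‖ ≤ g0 y * (‖y‖ ^ 2 + ‖w‖ ^ 2) := by gcongr
        _ = _ := by simp only [Pi.add_apply]; ring
  have V1 : ∫ y, g0 y * inner ℝ y w = 0 := by
    have h := integral_neg_eq_self (fun y => g0 y * inner ℝ y w) volume
    have h2 : ∀ y, g0 (-y) * inner ℝ (-y) w = -(g0 y * inner ℝ y w) := by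
      intro y; rw [hg, hg, norm_neg, inner_neg_left]; ring
    simp_rw [h2] at h
    rw [integral_neg] at h
    linarith
  have E : ∀ y, gaussPdf d θ v y * ‖y - μ‖ ^ 2 =
      (fun u => g0 u * ‖u‖ ^ 2 - 2 * (g0 u * inner ℝ u w) + ‖w‖ ^ 2 * g0 u) (y - θ) := by
    intro y
    have e1 : y - μ = (y - θ) - w := by rw [hw]; abel
    simp only [hg0]
    rw [e1, norm_sub_sq_real, show gaussPdf d θ v y = gaussPdf d 0 v (y - θ) by simp [gaussPdf]]
    ring
  have JJ := (J0.sub (J1.const_mul 2)).add (hgi.const_mul (‖w‖ ^ 2))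
  constructor
  · simp_rw [E]
    exact JJ.comp_sub_right θ
  · simp_rw [E]
    rw [integral_sub_right_eq_self (fun u => g0 u * ‖u‖ ^ 2 - 2 * (g0 u * inner ℝ u w) + ‖w‖ ^ 2 * g0 u) θ,
      int_lin3 2 (‖w‖ ^ 2) J0 J1 hgi, V0, V1, hgv]
    ring

lemma loss_kl (d : ℕ) (hd : 1 ≤ d) (v s : ℝ) (hv : 0 < v) (hs : 0 < s)
    (θ μ : EuclideanSpace ℝ (Fin d)) :
    lossA d (-1) (gaussPdf d θ v) (gaussPdf d μ (s * v)) =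
      d / 2 * Real.log s - d / 2 + d / (2 * s) + 1 / (2 * s) * (‖μ - θ‖ ^ 2 / v) := by
  rw [lossA, if_pos rfl]
  obtain ⟨i1, v1⟩ := gp_mom d hd v hv θ θ
  obtain ⟨i2, v2⟩ := gp_mom d hd v hv θ μ
  have l1 : Real.log (2 * π * (s * v)) = Real.log (2 * π * v) + Real.log s := by
    rw [← Real.log_mul (by positivity) (by positivity)]; congr 1; ring
  have key : ∀ y, gaussPdf d θ v y * Real.log (gaussPdf d θ v y / gaussPdf d μ (s * v) y) =
      gaussPdf d θ v y * (d / 2 * Real.log s) - 1 / (2 * v) * (gaussPdf d θ v y * ‖y - θ‖ ^ 2)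
      + 1 / (2 * (s * v)) * (gaussPdf d θ v y * ‖y - μ‖ ^ 2) := by
    intro y
    have : Real.log (gaussPdf d θ v y / gaussPdf d μ (s * v) y) = d / 2 * Real.log s -
      1 / (2 * v) * ‖y - θ‖ ^ 2 + 1 / (2 * (s * v)) * ‖y - μ‖ ^ 2 := by
      rw [gp_exp d μ (s * v) (by positivity), gp_exp d θ v hv, ← Real.exp_sub, Real.log_exp, l1]
      ring
    rw [this]; ring
  simp_rw [key]
  have i0 := (gp_int d θ v hv).mul_const (d / 2 * Real.log s)
  rw [int_lin3 _ _ i0 i1 i2, integral_mul_const, v1, v2, gp_val d θ v hv]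
  simp only [sub_self, norm_zero]
  field_simp
  ring

lemma log_ineq (γ β s : ℝ) (hγ : 0 < γ) (hβ : 0 < β) (h1 : γ + β = 1) (hs : 1 < s) :
    Real.log (γ * s + β) - γ * Real.log s < γ * β * (s - 1) ^ 2 / s := by
  have hs0 : 0 < s := by linarith
  have hm : 1 < γ * s + β := by nlinarith
  have a1 := Real.log_lt_sub_one_of_pos (by linarith : 0 < γ * s + β) hm.ne'
  have a2 := Real.log_le_sub_one_of_pos (by positivity : 0 < (γ * s + β) / s)
  rw [Real.log_div (by linarith) hs0.ne'] at a2
  have e : γ * β * (s - 1) ^ 2 / s = γ * ((γ * s + β) / s - 1) + β * (γ * s + β - 1) := by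
    have : β = 1 - γ := by linarith
    subst this
    field_simp
    ring
  rw [e]
  have : Real.log (γ * s + β) - γ * Real.log s =
      γ * (Real.log (γ * s + β) - Real.log s) + β * Real.log (γ * s + β) := by
    have : β = 1 - γ := by linarith
    rw [this]; ring
  rw [this]
  have := mul_le_mul_of_nonneg_left a2 hγ.le
  have := mul_lt_mul_of_pos_left a1 hβ
  linarith

lemma exp_int {E : Type*} [MeasurableSpace E] {m : Measure E} {g Z : E → ℝ}
    (hg : Integrable g m) (hZm : Measurable Z) (hZ : ∀ x, 0 ≤ Z x) (a : ℝ) (ha : 0 ≤ a) :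
    Integrable (fun x => g x * Real.exp (-(a * Z x))) m := by
  refine hg.mono (hg.1.mul (by fun_prop)) (Filter.Eventually.of_forall fun x => ?_)
  rw [norm_mul]
  have : ‖Real.exp (-(a * Z x))‖ ≤ 1 := by
    rw [Real.norm_of_nonneg (Real.exp_pos _).le, Real.exp_le_one_iff]
    have := mul_nonneg ha (hZ x); linarith
  nlinarith [norm_nonneg (g x)]

lemma expZ_int {E : Type*} [MeasurableSpace E] {m : Measure E} {g Z : E → ℝ}
    (hgZ : Integrable (fun x => g x * Z x) m) (hZm : Measurable Z) (hZ : ∀ x, 0 ≤ Z x)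
    (a : ℝ) (ha : 0 ≤ a) :
    Integrable (fun x => g x * (Z x * Real.exp (-(a * Z x)))) m := by
  refine (exp_int hgZ hZm hZ a ha).congr (Filter.Eventually.of_forall fun x => ?_)
  simp only; ring

/-- Tangent-line (Jensen) comparison of Laplace transforms. -/
lemma jensen_key {E : Type*} [MeasurableSpace E] {m : Measure E} {g Z : E → ℝ}
    (hg0 : ∀ x, 0 ≤ g x) (hg : Integrable g m) (hg1 : ∫ x, g x ∂m = 1)
    (hgZ : Integrable (fun x => g x * Z x) m) (hZm : Measurable Z) (hZ : ∀ x, 0 ≤ Z x)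
    (a b ε P : ℝ) (hb : 0 ≤ b) (hab : b < a) (hε : 0 < ε)
    (hW : ε ≤ ∫ x, g x * (Z x * Real.exp (-(a * Z x))) ∂m) (hP : 0 < P)
    (hPe : 1 < P * Real.exp ((a - b) * ε)) :
    ∫ x, g x * Real.exp (-(a * Z x)) ∂m < P * ∫ x, g x * Real.exp (-(b * Z x)) ∂m := by
  set φ := ∫ x, g x * Real.exp (-(a * Z x)) ∂m with hφ
  have i1 := exp_int hg hZm hZ a (by linarith)
  have i2 := exp_int hg hZm hZ b hb
  have i3 := expZ_int hgZ hZm hZ a (by linarith)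
  have hφ0 : 0 ≤ φ := integral_nonneg fun x => mul_nonneg (hg0 x) (Real.exp_pos _).le
  have hφ1 : φ ≤ 1 := by
    rw [← hg1]
    refine integral_mono i1 hg fun x => ?_
    have : Real.exp (-(a * Z x)) ≤ 1 := by
      rw [Real.exp_le_one_iff]
      have := mul_nonneg (by linarith : 0 ≤ a) (hZ x); linarith
    exact mul_le_of_le_one_right (hg0 x) this
  set u := (a - b) * ε with hu
  have hupos : 0 < u := mul_pos (by linarith) hε
  have hlow : Real.exp u * (φ * (1 - u) + u) ≤ ∫ x, g x * Real.exp (-(b * Z x)) ∂m := by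
    calc Real.exp u * (φ * (1 - u) + u)
        ≤ Real.exp u * (1 - u) * φ +
          Real.exp u * (a - b) * ∫ x, g x * (Z x * Real.exp (-(a * Z x))) ∂m := by
          have h1 : u ≤ (a - b) * ∫ x, g x * (Z x * Real.exp (-(a * Z x))) ∂m :=
            mul_le_mul_of_nonneg_left hW (by linarith)
          have := mul_le_mul_of_nonneg_left h1 (Real.exp_pos u).le
          nlinarith
      _ = ∫ x, (Real.exp u * (1 - u) * (g x * Real.exp (-(a * Z x))) +
          Real.exp u * (a - b) * (g x * (Z x * Real.exp (-(a * Z x))))) ∂m := by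
          rw [integral_add (i1.const_mul _) (i3.const_mul _), integral_const_mul,
            integral_const_mul]
      _ ≤ _ := by
          refine integral_mono ((i1.const_mul _).add (i3.const_mul _)) i2 fun x => ?_
          have h1 := Real.add_one_le_exp ((a - b) * Z x - u)
          have h2 : Real.exp (-(b * Z x)) =
              Real.exp u * Real.exp (-(a * Z x)) * Real.exp ((a - b) * Z x - u) := by
            rw [← Real.exp_add, ← Real.exp_add]; congr 1; ring
          rw [h2]
          have h3 : 0 ≤ g x * (Real.exp u * Real.exp (-(a * Z x))) :=
            mul_nonneg (hg0 x) (by positivity)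
          have := mul_le_mul_of_nonneg_left h1 h3
          simp only
          nlinarith
  have h4 : P * (Real.exp u * (φ * (1 - u) + u)) ≤ P * ∫ x, g x * Real.exp (-(b * Z x)) ∂m :=
    mul_le_mul_of_nonneg_left hlow hP.le
  refine lt_of_lt_of_le ?_ h4
  rw [← mul_assoc]
  have h5 : φ ≤ φ * (1 - u) + u := by nlinarith
  have h6 : 0 < φ * (1 - u) + u := by
    rcases hφ0.eq_or_lt with h | h
    · rw [← h]; linarith
    · linarith
  nlinarith

lemma cut_off (d : ℕ) (hd : 1 ≤ d) (α₀ ε τ k s : ℝ) (hα₀ : α₀ ∈ Set.Ioc (-1 : ℝ) 0)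
    (hτ : τ = (1 - α₀) * ε - 2 * α₀ * d)
    (hk : k = (τ + Real.sqrt (τ ^ 2 + 4 * (d : ℝ) ^ 2 * (1 - α₀ ^ 2))) / (2 * d * (1 - α₀)))
    (hs : 1 < s) (hsk : s ≤ k) :
    d * (s - 1) * ((1 - α₀) / 2 * s + (1 + α₀) / 2) ≤ (1 - α₀) / 2 * ε * s := by
  obtain ⟨h1, h2⟩ := hα₀
  have hd' : (1 : ℝ) ≤ d := by exact_mod_cast hd
  have hD : 0 < τ ^ 2 + 4 * (d : ℝ) ^ 2 * (1 - α₀ ^ 2) := by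
    have : 0 < 1 - α₀ ^ 2 := by nlinarith
    positivity
  set r := Real.sqrt (τ ^ 2 + 4 * (d : ℝ) ^ 2 * (1 - α₀ ^ 2)) with hr
  have hr2 : r ^ 2 = τ ^ 2 + 4 * (d : ℝ) ^ 2 * (1 - α₀ ^ 2) := Real.sq_sqrt hD.le
  have hrτ : |τ| ≤ r := Real.abs_le_sqrt (by
    have : 0 ≤ 1 - α₀ ^ 2 := by nlinarith
    have : 0 ≤ 4 * (d : ℝ) ^ 2 * (1 - α₀ ^ 2) := by positivity
    linarith)
  have hden : 0 < 2 * d * (1 - α₀) := by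
    have : 0 < 1 - α₀ := by linarith
    positivity
  have hq : 2 * d * (1 - α₀) * s - τ ≤ r := by
    rw [hk, le_div_iff₀ hden] at hsk; linarith
  have hq2 : -r ≤ 2 * d * (1 - α₀) * s - τ := by
    have := le_abs_self τ
    have : 0 < 2 * d * (1 - α₀) * s := by positivity
    linarith
  have hsq : (2 * d * (1 - α₀) * s - τ) ^ 2 ≤ r ^ 2 := sq_le_sq' hq2 hq
  rw [hr2] at hsq
  have h3 : 4 * (d * (1 - α₀)) * (d * (1 - α₀) * s ^ 2 - τ * s - d * (1 + α₀)) ≤ 0 := by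
    nlinarith
  have h4 : d * (1 - α₀) * s ^ 2 - τ * s - d * (1 + α₀) ≤ 0 := by
    by_contra hcon
    push Not at hcon
    have : 0 < 4 * (d * (1 - α₀)) * (d * (1 - α₀) * s ^ 2 - τ * s - d * (1 + α₀)) := by
      apply mul_pos _ hcon; linarith
    linarith
  rw [hτ] at h4
  nlinarith

lemma cut_off' (D α₀ α ε s : ℝ) (hD : 0 ≤ D) (h1 : -1 < α₀) (h2 : α₀ ≤ 0) (ha : -1 ≤ α)
    (hα : α ≤ α₀) (hs : 1 < s)
    (h : D * (s - 1) * ((1 - α₀) / 2 * s + (1 + α₀) / 2) ≤ (1 - α₀) / 2 * ε * s) :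
    D * (s - 1) * ((1 - α) / 2 * s + (1 + α) / 2) ≤ (1 - α) / 2 * ε * s := by
  have hA : 0 < (1 - α₀) / 2 := by linarith
  have hB : 0 < (1 - α) / 2 := by linarith
  have e : (1 - α₀) / 2 * ((1 - α) / 2 * s + (1 + α) / 2) ≤
      (1 - α) / 2 * ((1 - α₀) / 2 * s + (1 + α₀) / 2) := by nlinarith
  have e1 := mul_le_mul_of_nonneg_left e (mul_nonneg hD (by linarith : 0 ≤ s - 1))
  have e2 := mul_le_mul_of_nonneg_left h hB.le
  have e3 : (1 - α₀) / 2 * (D * (s - 1) * ((1 - α) / 2 * s + (1 + α) / 2)) ≤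
      (1 - α₀) / 2 * ((1 - α) / 2 * ε * s) := by nlinarith
  exact le_of_mul_le_mul_left e3 hA

set_option maxHeartbeats 1000000 in
theorem stmt18 (d : ℕ) (hd : 1 ≤ d) (σX σY : ℝ) (hσX : 0 < σX) (hσY : 0 < σY)
    (C : Set (EuclideanSpace ℝ (Fin d))) (hC : C.Nonempty)
    (θhat : EuclideanSpace ℝ (Fin d) → EuclideanSpace ℝ (Fin d)) (hmeas : Measurable θhat)
    (hfin : ∀ θ ∈ C, Integrable
      (fun x => gaussPdf d θ (σX ^ 2) x * ‖θhat x - θ‖ ^ 2))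
    (α₀ : ℝ) (hα₀ : α₀ ∈ Set.Ioc (-1 : ℝ) 0)
    (ε : ℝ)
    (hε : ε = ⨅ θ : C, ∫ x, gaussPdf d θ (σX ^ 2) x *
        ((‖θhat x - (θ : EuclideanSpace ℝ (Fin d))‖ ^ 2 / σY ^ 2) *
          Real.exp (-(1 - α₀ ^ 2) *
            (‖θhat x - (θ : EuclideanSpace ℝ (Fin d))‖ ^ 2 / σY ^ 2) / 8)))
    (hεpos : 0 < ε)
    (τ k : ℝ) (hτ : τ = (1 - α₀) * ε - 2 * α₀ * d)
    (hk : k = (τ + Real.sqrt (τ ^ 2 + 4 * (d : ℝ) ^ 2 * (1 - α₀ ^ 2))) / (2 * d * (1 - α₀))) :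
    ∀ c : ℝ, 1 < c ^ 2 → c ^ 2 ≤ k → ∀ α ∈ Set.Icc (-1 : ℝ) α₀,
      (∀ θ ∈ C, riskA d α σX σY θhat c θ ≤ riskA d α σX σY θhat 1 θ) ∧
      ∃ θ ∈ C, riskA d α σX σY θhat c θ < riskA d α σX σY θhat 1 θ := by
  intro c hc hck α hα
  suffices H : ∀ θ ∈ C, riskA d α σX σY θhat c θ < riskA d α σX σY θhat 1 θ by
    obtain ⟨θ, hθ⟩ := hC
    exact ⟨fun θ hθ => (H θ hθ).le, θ, hθ, H θ hθ⟩
  intro θ hθ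
  obtain ⟨ha1, ha2⟩ := hα
  have hcut0 := cut_off d hd α₀ ε τ k (c ^ 2) hα₀ hτ hk hc hck
  obtain ⟨h01, h02⟩ := hα₀
  have hd' : (1 : ℝ) ≤ d := by exact_mod_cast hd
  have hcut := cut_off' d α₀ α ε (c ^ 2) (by linarith) h01 h02 ha1 ha2 hc hcut0
  set s := c ^ 2 with hs
  have hs0 : 0 < s := by linarith
  have hvX : 0 < σX ^ 2 := by positivity
  have hvY : 0 < σY ^ 2 := by positivity
  set g := gaussPdf d θ (σX ^ 2) with hg
  set Z : EuclideanSpace ℝ (Fin d) → ℝ := fun x => ‖θhat x - θ‖ ^ 2 / σY ^ 2 with hZdef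
  have hg0 : ∀ x, 0 ≤ g x := fun x => (gp_pos d θ _ hvX x).le
  have hgi : Integrable g := gp_int d θ _ hvX
  have hg1 : ∫ x, g x = 1 := gp_val d θ _ hvX
  have hZm : Measurable Z := by
    have : Measurable fun x => θhat x - θ := hmeas.sub_const θ
    exact (this.norm.pow_const 2).div_const _
  have hZ0 : ∀ x, 0 ≤ Z x := fun x => by positivity
  have hgZ : Integrable (fun x => g x * Z x) := by
    refine ((hfin θ hθ).div_const (σY ^ 2)).congr (Filter.Eventually.of_forall fun x => ?_)
    simp only [hZdef]; ring
  have hε1 : ε ≤ ∫ x, g x * (Z x * Real.exp (-((1 - α₀ ^ 2) / 8 * Z x))) := by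
    rw [hε]
    refine (ciInf_le ⟨0, ?_⟩ (⟨θ, hθ⟩ : C)).trans (le_of_eq ?_)
    · rintro _ ⟨t, rfl⟩
      refine integral_nonneg fun x => mul_nonneg (gp_pos d _ _ hvX x).le ?_
      positivity
    · refine integral_congr_ae (Filter.Eventually.of_forall fun x => ?_)
      simp only [hZdef, hg]
      congr 3
      ring
  have h0sq : 0 ≤ (1 - α₀ ^ 2) / 8 := by nlinarith
  have hεa : ∀ a : ℝ, 0 ≤ a → a ≤ (1 - α₀ ^ 2) / 8 →
      ε ≤ ∫ x, g x * (Z x * Real.exp (-(a * Z x))) := by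
    intro a ha hle
    refine hε1.trans (integral_mono (expZ_int hgZ hZm hZ0 _ h0sq) (expZ_int hgZ hZm hZ0 a ha)
      fun x => ?_)
    have := mul_le_mul_of_nonneg_right hle (hZ0 x)
    have h1 := hg0 x
    have h2 := hZ0 x
    simp only
    gcongr
  rcases ha1.eq_or_lt with hα1 | hα1
  · -- Kullback–Leibler case
    subst hα1
    have hEZ : ε ≤ ∫ x, g x * Z x := by
      have := hεa 0 le_rfl h0sq
      simpa using this
    have R : ∀ b : ℝ, 0 < b ^ 2 → riskA d (-1) σX σY θhat b θ =
        (d / 2 * Real.log (b ^ 2) - d / 2 + d / (2 * b ^ 2)) + 1 / (2 * b ^ 2) * ∫ x, g x * Z x := by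
      intro b hb
      rw [riskA]
      have : ∀ x, gaussPdf d θ (σX ^ 2) x * lossA d (-1) (gaussPdf d θ (σY ^ 2))
          (gaussPdf d (θhat x) (b ^ 2 * σY ^ 2)) =
          (d / 2 * Real.log (b ^ 2) - d / 2 + d / (2 * b ^ 2)) * g x
            + 1 / (2 * b ^ 2) * (g x * Z x) := by
        intro x
        rw [loss_kl d hd _ _ hvY hb]
        simp only [hZdef, hg]; ring
      simp_rw [this]
      rw [integral_add (hgi.const_mul _) (hgZ.const_mul _), integral_const_mul,
        integral_const_mul, hg1, mul_one]
    rw [R c hs0, R 1 (by norm_num), ← hs]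
    simp only [one_pow, Real.log_one, mul_one, mul_zero]
    set M := ∫ x, g x * Z x
    have hl := Real.log_lt_sub_one_of_pos hs0 hc.ne'
    have h3 : d * (s - 1) ≤ ε := by
      norm_num at hcut
      have : d * (s - 1) * s ≤ ε * s := by linarith
      exact le_of_mul_le_mul_right this hs0
    have h4 : d / 2 * Real.log s < d / 2 * (s - 1) :=
      mul_lt_mul_of_pos_left hl (by linarith)
    have h5 : d / 2 * (s - 1) - d / 2 + d / (2 * s) + 1 / (2 * s) * M ≤ 0 - d / 2 + d / 2 + 1 / 2 * M := by
      rw [← sub_nonneg]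
      have : 0 - d / 2 + d / 2 + 1 / 2 * M - (d / 2 * (s - 1) - d / 2 + d / (2 * s) + 1 / (2 * s) * M)
          = (s - 1) * (M - d * (s - 1)) / (2 * s) := by
        field_simp; ring
      rw [this]
      apply div_nonneg (mul_nonneg (by linarith) (by linarith)) (by linarith)
    linarith
  · -- α-divergence case
    have hγ : 0 < (1 - α) / 2 := by linarith
    have hβ : 0 < (1 + α) / 2 := by linarith
    have hsq : 0 < 1 - α ^ 2 := by nlinarith
    set m := (1 - α) / 2 * s + (1 + α) / 2 with hm
    have hm1 : 1 < m := by rw [hm]; nlinarith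
    set a := (1 - α ^ 2) / 8 with ha
    have ha0 : 0 < a := by positivity
    set P := Real.exp (d / 2 * ((1 - α) / 2 * Real.log s - Real.log m)) with hP
    have R : ∀ b : ℝ, 0 < b ^ 2 → riskA d α σX σY θhat b θ =
        4 / (1 - α ^ 2) * (1 - Real.exp (d / 2 * ((1 - α) / 2 * Real.log (b ^ 2)
          - Real.log ((1 - α) / 2 * b ^ 2 + (1 + α) / 2))) *
          ∫ x, g x * Real.exp (-(a / ((1 - α) / 2 * b ^ 2 + (1 + α) / 2) * Z x))) := by
      intro b hb
      rw [riskA]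
      have hmb : 0 < (1 - α) / 2 * b ^ 2 + (1 + α) / 2 := by positivity
      have : ∀ x, gaussPdf d θ (σX ^ 2) x * lossA d α (gaussPdf d θ (σY ^ 2))
          (gaussPdf d (θhat x) (b ^ 2 * σY ^ 2)) =
          4 / (1 - α ^ 2) * (g x - Real.exp (d / 2 * ((1 - α) / 2 * Real.log (b ^ 2)
          - Real.log ((1 - α) / 2 * b ^ 2 + (1 + α) / 2))) *
          (g x * Real.exp (-(a / ((1 - α) / 2 * b ^ 2 + (1 + α) / 2) * Z x)))) := by
        intro x
        rw [loss_alpha d α _ _ hα1 (by linarith) hvY hb]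
        simp only [hZdef, hg, ha]; ring
      simp_rw [this]
      rw [integral_const_mul, integral_sub hgi
        ((exp_int hgi hZm hZ0 _ (by positivity)).const_mul _), integral_const_mul, hg1]
    rw [R c hs0, R 1 (by norm_num), ← hs, ← hm]
    have e1 : (1 - α) / 2 * 1 ^ 2 + (1 + α) / 2 = 1 := by ring
    rw [e1]
    simp only [one_pow, Real.log_one, mul_zero, sub_zero, Real.exp_zero, one_mul, div_one]
    rw [← hP]
    have hale : a ≤ (1 - α₀ ^ 2) / 8 := by rw [ha]; nlinarith
    have hba : a / m < a := div_lt_self ha0 hm1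
    have J := jensen_key hg0 hgi hg1 hgZ hZm hZ0 a (a / m) ε P (by positivity) hba hεpos
      (hεa a ha0.le hale) (Real.exp_pos _) (by
        rw [hP, ← Real.exp_add, Real.one_lt_exp_iff]
        have hl := log_ineq _ _ s hγ hβ (by ring) hc
        rw [← hm] at hl
        have h6 : d / 2 * ((1 - α) / 2 * ((1 + α) / 2) * (s - 1) ^ 2 / s) ≤ (a - a / m) * ε := by
          have hm0 : 0 < m := by linarith
          have e2 : (a - a / m) * ε - d / 2 * ((1 - α) / 2 * ((1 + α) / 2) * (s - 1) ^ 2 / s) =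
              (1 + α) / 4 * ((1 - α) / 2) * (s - 1) / (m * s) *
                ((1 - α) / 2 * ε * s - d * (s - 1) * m) := by
            have : m - 1 = (1 - α) / 2 * (s - 1) := by rw [hm]; ring
            have e3 : a - a / m = a * ((1 - α) / 2 * (s - 1)) / m := by
              rw [← this]; field_simp
            rw [e3, ha]
            field_simp
            ring
          rw [← sub_nonneg, e2]
          have : 0 < s - 1 := by linarith
          have : 0 < (1 + α) / 4 := by linarith
          exact mul_nonneg (by positivity) (by linarith)
        have h7 := mul_lt_mul_of_pos_left hl (by linarith : (0 : ℝ) < d / 2)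
        linarith)
    have h4 : 0 < 4 / (1 - α ^ 2) := by positivity
    have h8 := sub_lt_sub_left J 1
    exact mul_lt_mul_of_pos_left h8 h4
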